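/- Define the model operator T₊ on L²(ℝ₊) by (T₊u)(x) = (2π)^{−1} ∫₀^∞ ∫₀^∞ e^{iξ(x−y)} u(y) dy dξ (interpreted as χ_{ℝ₊} F^{−1} χ_{ℝ₊} F χ_{ℝ₊} where F is the Fourier transform). Then under the Mellin transform M : L²(ℝ₊) → L²(ℝ), (Mu)(s) = (2π)^{−1/2} ∫₀^∞ x^{−1/2+is} u(x) dx, the operator T₊ is unitarily equivalent to multiplication by the function s ↦ 1/(1 + e^{2πs}) on L²(ℝ). In particular, the spectrum of T₊ is [0,1] and T₊ has no eigenvalues. -/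

import Mathlib

open MeasureTheory Complex

theorem integrableOn_cpow_mul_exp_neg_mul {a r : ℂ} (ha : 0 < a.re) (hr : 0 < r.re) :
    IntegrableOn (fun t : ℝ => (t : ℂ) ^ (a - 1) * Complex.exp (-(r * t))) (Set.Ioi 0) := by
  have h := integrableOn_rpow_mul_exp_neg_mul_rpow (p := 1) (s := a.re - 1) (b := r.re)
    (by linarith) one_pos hr
  refine Integrable.mono' h ?_ ?_
  · refine (ContinuousOn.mul ?_ (by fun_prop)).aestronglyMeasurable measurableSet_Ioi
    exact fun t ht => (ContinuousAt.comp (f := fun t : ℝ => (t : ℂ))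
      (continuousAt_cpow_const (Or.inl (by simpa using ht)))
      continuous_ofReal.continuousAt).continuousWithinAt
  · filter_upwards [ae_restrict_mem measurableSet_Ioi] with t ht
    rw [norm_mul, norm_cpow_eq_rpow_re_of_pos ht, norm_exp]
    simp

/-- The Gamma integral with a complex rate in the right half-plane. -/
theorem integral_cpow_mul_exp_neg_complex_mul {a r : ℂ} (ha : 0 < a.re) (hr : 0 < r.re) :
    ∫ t : ℝ in Set.Ioi 0, (t : ℂ) ^ (a - 1) * Complex.exp (-(r * t)) =
      (1 / r) ^ a * Complex.Gamma a := by
  have hopen : IsOpen {r : ℂ | 0 < r.re} := isOpen_lt continuous_const continuous_re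
  have hconv : IsPreconnected {r : ℂ | 0 < r.re} := (convex_halfSpace_re_gt 0).isPreconnected
  have hF : DifferentiableOn ℂ (fun r : ℂ => ∫ t : ℝ in Set.Ioi 0,
      (t : ℂ) ^ (a - 1) * Complex.exp (-(r * t))) {r : ℂ | 0 < r.re} := by
    intro r₀ hr₀
    have hr₀' : 0 < r₀.re := hr₀
    have key := hasDerivAt_integral_of_dominated_loc_of_deriv_le
      (μ := volume.restrict (Set.Ioi (0 : ℝ))) (𝕜 := ℂ)
      (F := fun (r : ℂ) (t : ℝ) => (t : ℂ) ^ (a - 1) * Complex.exp (-(r * t)))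
      (F' := fun (r : ℂ) (t : ℝ) => (t : ℂ) ^ (a - 1) * (Complex.exp (-(r * t)) * (-t)))
      (x₀ := r₀) (s := {r : ℂ | r₀.re / 2 < r.re})
      (bound := fun t => t ^ a.re * Real.exp (-(r₀.re / 2) * t ^ (1 : ℝ)))
      ((isOpen_lt continuous_const continuous_re).mem_nhds (by simp [hr₀']))
      ?_ (integrableOn_cpow_mul_exp_neg_mul ha hr₀) ?_ ?_ ?_ ?_
    · exact key.2.differentiableAt.differentiableWithinAt
    · filter_upwards [hopen.mem_nhds hr₀] with r hr
      exact (integrableOn_cpow_mul_exp_neg_mul ha hr).aestronglyMeasurable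
    · have := (integrableOn_cpow_mul_exp_neg_mul ha hr₀).aestronglyMeasurable
      refine (this.mul (g := fun t : ℝ => -(t : ℂ)) (by fun_prop)).congr ?_
      filter_upwards with t
      simp only [Pi.mul_apply]
      ring
    · filter_upwards [ae_restrict_mem measurableSet_Ioi] with t ht r hr
      have ht' : 0 < t := ht
      have hr' : r₀.re / 2 < r.re := hr
      rw [norm_mul, norm_mul, norm_cpow_eq_rpow_re_of_pos ht, norm_exp, norm_neg, norm_real,
        Real.norm_of_nonneg ht'.le, mul_comm (Real.exp _), ← mul_assoc]
      have : t ^ (a - 1).re * t = t ^ a.re := by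
        rw [← Real.rpow_add_one ht'.ne']; simp
      rw [this]
      gcongr
      rw [neg_re, re_mul_ofReal, Real.rpow_one]
      nlinarith
    · exact integrableOn_rpow_mul_exp_neg_mul_rpow (by linarith) one_pos (by linarith)
    · filter_upwards with t r hr
      exact ((((hasDerivAt_id r).mul_const (t : ℂ)).neg.cexp).const_mul
        ((t : ℂ) ^ (a - 1))).congr_deriv (by simp)
  have hG : DifferentiableOn ℂ (fun r : ℂ => (1 / r) ^ a * Complex.Gamma a)
      {r : ℂ | 0 < r.re} := by
    intro r hr
    have hr' : 0 < r.re := hr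
    have hr0 : r ≠ 0 := fun h => by simp [h] at hr'
    refine DifferentiableAt.differentiableWithinAt (DifferentiableAt.mul_const
      (DifferentiableAt.cpow_const ?_ ?_) _)
    · exact (differentiableAt_const 1).div differentiableAt_id hr0
    · left
      rw [one_div, inv_re]
      exact div_pos hr' (normSq_pos.mpr hr0)
  refine (hF.analyticOnNhd hopen).eqOn_of_preconnected_of_frequently_eq (hG.analyticOnNhd hopen)
    hconv (z₀ := 1) (by simp) ?_ hr
  have hseq : Filter.Tendsto (fun n : ℕ => ((1 + 1 / ((n : ℝ) + 1) : ℝ) : ℂ)) Filter.atTop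
      (nhdsWithin 1 {1}ᶜ) := by
    refine tendsto_nhdsWithin_iff.mpr ⟨?_, ?_⟩
    · have := (tendsto_one_div_add_atTop_nhds_zero_nat (𝕜 := ℝ)).const_add 1
      simpa [Function.comp_def] using (continuous_ofReal.tendsto _).comp this
    · filter_upwards with n h
      have : (1 + 1 / ((n : ℝ) + 1) : ℝ) = 1 := ofReal_injective (by simpa using h)
      have : 1 / ((n : ℝ) + 1) > 0 := by positivity
      linarith
  refine hseq.frequently (Filter.Frequently.of_forall fun n => ?_)
  exact integral_cpow_mul_exp_neg_mul_Ioi ha (by positivity)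

theorem integrable_cpow_mul_exp_prod {c d z : ℂ} (hc : 0 < c.re) (hd : 0 < d.re)
    (hz : 0 < z.re) (hz' : z.re < 1) :
    Integrable (fun p : ℝ × ℝ => (p.1 : ℂ) ^ (-z) * Complex.exp (-(p.2 * (d + c * p.1))))
      ((volume.restrict (Set.Ioi (0 : ℝ))).prod (volume.restrict (Set.Ioi (0 : ℝ)))) := by
  have hmeas : Measurable
      (fun p : ℝ × ℝ => (p.1 : ℂ) ^ (-z) * Complex.exp (-(p.2 * (d + c * p.1)))) := by
    fun_prop
  have hnorm : ∀ ξ : ℝ, ∀ t ∈ Set.Ioi (0 : ℝ),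
      ‖(t : ℂ) ^ (-z) * Complex.exp (-(ξ * (d + c * t)))‖ =
        Real.exp (-(d.re * ξ)) * (t ^ ((1 - z.re) - 1) * Real.exp (-((ξ * c.re) * t))) := by
    intro ξ t ht
    rw [norm_mul, norm_cpow_eq_rpow_re_of_pos ht, norm_exp, mul_left_comm, ← Real.exp_add]
    congr 2
    · simp
    · simp; ring
  rw [integrable_prod_iff' hmeas.aestronglyMeasurable]
  constructor
  · filter_upwards [ae_restrict_mem measurableSet_Ioi] with ξ hξ
    have hξ' : 0 < ξ := hξ
    have h := (integrableOn_rpow_mul_exp_neg_mul_rpow (p := 1) (s := (1 - z.re) - 1)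
      (b := ξ * c.re) (by linarith) one_pos (by positivity)).const_mul (Real.exp (-(d.re * ξ)))
    refine Integrable.mono' h (by fun_prop) ?_
    filter_upwards [ae_restrict_mem measurableSet_Ioi] with t ht
    rw [hnorm ξ t ht]
    simp
  · have h := (integrableOn_rpow_mul_exp_neg_mul_rpow (p := 1) (s := z.re - 1)
      (b := d.re) (by linarith) one_pos hd).mul_const
        ((1 / c.re) ^ (1 - z.re) * Real.Gamma (1 - z.re))
    refine h.congr ?_
    filter_upwards [ae_restrict_mem measurableSet_Ioi] with ξ hξ
    have hξ' : 0 < ξ := hξ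
    rw [setIntegral_congr_fun measurableSet_Ioi (hnorm ξ), integral_const_mul,
      Real.integral_rpow_mul_exp_neg_mul_Ioi (by linarith) (by positivity)]
    have : (1 / (ξ * c.re)) ^ (1 - z.re) = ξ ^ (z.re - 1) * (1 / c.re) ^ (1 - z.re) := by
      rw [one_div, mul_inv, Real.mul_rpow (by positivity) (by positivity), one_div,
        Real.inv_rpow hξ'.le, ← Real.rpow_neg hξ'.le, neg_sub]
    rw [this, Real.rpow_one, neg_mul]
    ring

theorem integral_exp_neg_mul_Ioi_complex {w : ℂ} (hw : 0 < w.re) :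
    ∫ ξ : ℝ in Set.Ioi 0, Complex.exp (-(ξ * w)) = 1 / w := by
  have h := integral_exp_mul_complex_Ioi (a := -w) (by simpa using hw) 0
  simpa [mul_comm] using h

theorem integrableOn_cpow_mul_inv_add {c d z : ℂ} (hc : 0 < c.re) (hd : 0 < d.re)
    (hz : 0 < z.re) (hz' : z.re < 1) :
    IntegrableOn (fun t : ℝ => (t : ℂ) ^ (-z) * (1 / (d + c * t))) (Set.Ioi 0) := by
  refine (integrable_cpow_mul_exp_prod hc hd hz hz').integral_prod_left.congr ?_
  filter_upwards [ae_restrict_mem measurableSet_Ioi] with t ht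
  have ht' : 0 < t := ht
  rw [integral_const_mul, integral_exp_neg_mul_Ioi_complex (by simp; positivity)]

theorem integral_cpow_mul_inv_add {c d z : ℂ} (hc : 0 < c.re) (hd : 0 < d.re)
    (hz : 0 < z.re) (hz' : z.re < 1) :
    ∫ t : ℝ in Set.Ioi 0, (t : ℂ) ^ (-z) * (1 / (d + c * t)) =
      (1 / c) ^ (1 - z) * (1 / d) ^ z * (Real.pi / Complex.sin (Real.pi * z)) := by
  have hc0 : c ≠ 0 := fun h => by simp [h] at hc
  calc ∫ t : ℝ in Set.Ioi 0, (t : ℂ) ^ (-z) * (1 / (d + c * t))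
      = ∫ t : ℝ in Set.Ioi 0, ∫ ξ : ℝ in Set.Ioi 0,
          (t : ℂ) ^ (-z) * Complex.exp (-(ξ * (d + c * t))) := by
        refine setIntegral_congr_fun measurableSet_Ioi fun t ht => ?_
        have ht' : 0 < t := ht
        rw [integral_const_mul, integral_exp_neg_mul_Ioi_complex (by simp; positivity)]
    _ = ∫ ξ : ℝ in Set.Ioi 0, ∫ t : ℝ in Set.Ioi 0,
          (t : ℂ) ^ (-z) * Complex.exp (-(ξ * (d + c * t))) :=
        integral_integral_swap (integrable_cpow_mul_exp_prod hc hd hz hz')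
    _ = ∫ ξ : ℝ in Set.Ioi 0, ((1 / c) ^ (1 - z) * Complex.Gamma (1 - z)) *
          ((ξ : ℂ) ^ (z - 1) * Complex.exp (-(d * ξ))) := by
        refine setIntegral_congr_fun measurableSet_Ioi fun ξ hξ => ?_
        have hξ' : 0 < ξ := hξ
        have h := integral_cpow_mul_exp_neg_complex_mul (a := 1 - z) (r := ξ * c)
          (by simpa using hz') (by simp; positivity)
        have e : ∀ t : ℝ, (t : ℂ) ^ (-z) * Complex.exp (-(ξ * (d + c * t))) =
            Complex.exp (-(d * ξ)) * ((t : ℂ) ^ (1 - z - 1) * Complex.exp (-(ξ * c * t))) := by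
          intro t
          rw [mul_left_comm, ← Complex.exp_add]
          congr 2 <;> ring
        simp only [e]
        rw [integral_const_mul, h]
        have e2 : (1 / ((ξ : ℂ) * c)) ^ (1 - z) = (ξ : ℂ) ^ (z - 1) * (1 / c) ^ (1 - z) := by
          have : 1 / ((ξ : ℂ) * c) = ((ξ⁻¹ : ℝ) : ℂ) * (1 / c) := by
            push_cast; field_simp
          rw [this, cpow_def_of_ne_zero (by simp [hξ'.ne', hc0]), cpow_def_of_ne_zero (by simp [hξ'.ne']),
            cpow_def_of_ne_zero (by simp [hc0]), log_ofReal_mul (by positivity) (by simp [hc0]),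
            Real.log_inv, ← ofReal_log hξ'.le, ← Complex.exp_add]
          push_cast
          ring_nf
        rw [e2]
        ring
    _ = _ := by
        rw [integral_const_mul, integral_cpow_mul_exp_neg_complex_mul hz hd,
          ← Complex.Gamma_mul_Gamma_one_sub]
        ring

/-- The kernel `K(1, t)` of the model operator with the first variable rotated off the real axis
by the angle `π - 2 α`. -/
noncomputable def rotKernel (α t : ℝ) : ℂ :=
  (2 * Real.pi)⁻¹ * (1 / (I * Complex.exp (-(2 * α) * I) + I * t))

/-- The Mellin symbol of `rotKernel`. -/
noncomputable def rotSymbol (α s : ℝ) : ℂ :=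
  -I * Complex.exp (α * I) * (Real.exp (-2 * α * s) / (2 * Real.cosh (Real.pi * s)) : ℝ)

theorem rotKernel_eq (α t : ℝ) : rotKernel α t = (2 * Real.pi)⁻¹ * (-I * Complex.exp (α * I)) *
    (1 / (Complex.exp (-α * I) + Complex.exp (α * I) * t)) := by
  have h : I * Complex.exp (-(2 * α) * I) + I * t =
      (I * Complex.exp (-α * I)) * (Complex.exp (-α * I) + Complex.exp (α * I) * t) := by
    have h1 : Complex.exp (-(2 * α) * I) = Complex.exp (-α * I) * Complex.exp (-α * I) := by
      rw [← Complex.exp_add]; ring_nf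
    have h2 : Complex.exp (-α * I) * Complex.exp (α * I) = 1 := by
      rw [← Complex.exp_add]; simp
    rw [h1]
    linear_combination (-I * t) * h2
  have h3 : 1 / (I * Complex.exp (-α * I)) = -I * Complex.exp (α * I) := by
    rw [one_div, mul_inv, inv_I, ← Complex.exp_neg]; simp
  rw [rotKernel, h, ← h3]
  simp only [one_div, mul_inv]
  ring

theorem exp_mul_I_re_pos {α : ℝ} (h0 : 0 < α) (h1 : α < Real.pi / 2) :
    0 < (Complex.exp (α * I)).re := by
  rw [exp_ofReal_mul_I_re]
  exact Real.cos_pos_of_mem_Ioo ⟨by linarith [Real.pi_pos], h1⟩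

theorem exp_neg_mul_I_re_pos {α : ℝ} (h0 : 0 < α) (h1 : α < Real.pi / 2) :
    0 < (Complex.exp (-α * I)).re := by
  rw [← ofReal_neg, exp_ofReal_mul_I_re, Real.cos_neg]
  exact Real.cos_pos_of_mem_Ioo ⟨by linarith [Real.pi_pos], h1⟩

theorem integrableOn_cpow_mul_rotKernel {α : ℝ} (h0 : 0 < α) (h1 : α < Real.pi / 2) (s : ℝ) :
    IntegrableOn (fun t : ℝ => (t : ℂ) ^ (-(1 / 2 + I * s)) * rotKernel α t) (Set.Ioi 0) := by
  have h := (integrableOn_cpow_mul_inv_add (z := 1 / 2 + I * s) (exp_mul_I_re_pos h0 h1)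
    (exp_neg_mul_I_re_pos h0 h1) (by simp) (by simp; norm_num)).const_mul
      ((2 * Real.pi)⁻¹ * (-I * Complex.exp (α * I)))
  refine h.congr (ae_of_all _ fun t => ?_)
  simp only [rotKernel_eq]
  ring

theorem integral_cpow_mul_rotKernel {α : ℝ} (h0 : 0 < α) (h1 : α < Real.pi / 2) (s : ℝ) :
    ∫ t : ℝ in Set.Ioi 0, (t : ℂ) ^ (-(1 / 2 + I * s)) * rotKernel α t = rotSymbol α s := by
  have h := integral_cpow_mul_inv_add (z := 1 / 2 + I * s) (exp_mul_I_re_pos h0 h1)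
    (exp_neg_mul_I_re_pos h0 h1) (by simp) (by simp; norm_num)
  have e : ∀ t : ℝ, (t : ℂ) ^ (-(1 / 2 + I * s)) * rotKernel α t =
      ((2 * Real.pi)⁻¹ * (-I * Complex.exp (α * I))) * ((t : ℂ) ^ (-(1 / 2 + I * s)) *
        (1 / (Complex.exp (-α * I) + Complex.exp (α * I) * t))) := by
    intro t
    rw [rotKernel_eq]
    ring
  simp only [e]
  rw [integral_const_mul, h]
  have hsin : Complex.sin (Real.pi * (1 / 2 + I * s)) = Real.cosh (Real.pi * s) := by
    have : (Real.pi : ℂ) * (1 / 2 + I * s) = (Real.pi * s) * I + Real.pi / 2 := by ring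
    rw [this, Complex.sin_add_pi_div_two, Complex.cos_mul_I]
    push_cast; rfl
  have hp := Real.pi_pos
  have l1 : Complex.log (1 / Complex.exp (α * I)) = -α * I := by
    rw [one_div, ← Complex.exp_neg, ← neg_mul, Complex.log_exp] <;> simp <;> linarith
  have l2 : Complex.log (1 / Complex.exp (-α * I)) = α * I := by
    rw [one_div, ← Complex.exp_neg, ← neg_mul, neg_neg, Complex.log_exp] <;> simp <;> linarith
  rw [hsin, cpow_def_of_ne_zero (by simp), cpow_def_of_ne_zero (by simp), l1, l2,
    ← Complex.exp_add]
  have he : -α * I * (1 - (1 / 2 + I * s)) + α * I * (1 / 2 + I * s) = ((-2 * α * s : ℝ) : ℂ) := by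
    push_cast
    linear_combination (2 * α * s : ℂ) * I_sq
  rw [he, rotSymbol]
  have hcosh : (Real.cosh (Real.pi * s) : ℂ) ≠ 0 := by exact_mod_cast (Real.cosh_pos _).ne'
  have hpi : (Real.pi : ℂ) ≠ 0 := by exact_mod_cast hp.ne'
  rw [ofReal_div, ofReal_mul, ofReal_exp]
  push_cast at hcosh ⊢
  field_simp

theorem norm_rotSymbol_le {α : ℝ} (h0 : 0 < α) (h1 : α < Real.pi / 2) (s : ℝ) :
    ‖rotSymbol α s‖ ≤ 1 := by
  rw [rotSymbol, norm_mul, norm_mul, norm_neg, norm_I, norm_exp_ofReal_mul_I, norm_real, one_mul,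
    one_mul, Real.norm_of_nonneg (by positivity), div_le_one (by positivity), Real.cosh_eq]
  rcases le_total 0 s with hs | hs
  · have : Real.exp (-2 * α * s) ≤ Real.exp (Real.pi * s) := Real.exp_le_exp.mpr (by nlinarith)
    linarith [Real.exp_pos (-(Real.pi * s))]
  · have : Real.exp (-2 * α * s) ≤ Real.exp (-(Real.pi * s)) := Real.exp_le_exp.mpr (by nlinarith)
    linarith [Real.exp_pos (Real.pi * s)]

theorem continuous_rotSymbol (α : ℝ) : Continuous (rotSymbol α) := by
  unfold rotSymbol
  have : ∀ s, 2 * Real.cosh (Real.pi * s) ≠ 0 := fun s => by positivity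
  fun_prop (disch := simpa using this)

theorem tendsto_rotSymbol (s : ℝ) : Filter.Tendsto (fun α => rotSymbol α s)
    (nhdsWithin (Real.pi / 2) (Set.Iio (Real.pi / 2)))
    (nhds (((1 + Real.exp (2 * Real.pi * s))⁻¹ : ℝ) : ℂ)) := by
  have hc : Continuous (fun α => rotSymbol α s) := by
    unfold rotSymbol
    fun_prop
  have hv : rotSymbol (Real.pi / 2) s = (((1 + Real.exp (2 * Real.pi * s))⁻¹ : ℝ) : ℂ) := by
    have h1 : -I * Complex.exp ((Real.pi / 2 : ℝ) * I) = 1 := by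
      push_cast
      rw [Complex.exp_pi_div_two_mul_I]
      simp
    rw [rotSymbol, h1, one_mul, ofReal_inj, Real.cosh_eq]
    have e1 : Real.exp (2 * Real.pi * s) = Real.exp (Real.pi * s) * Real.exp (Real.pi * s) := by
      rw [← Real.exp_add]; ring_nf
    have e2 : Real.exp (-2 * (Real.pi / 2) * s) = (Real.exp (Real.pi * s))⁻¹ := by
      rw [← Real.exp_neg]; ring_nf
    rw [e1, e2, Real.exp_neg]
    have := Real.exp_pos (Real.pi * s)
    field_simp
    ring
  rw [← hv]
  exact (hc.tendsto _).mono_left nhdsWithin_le_nhds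

theorem rot_re_pos {α : ℝ} (h0 : 0 < α) (h1 : α < Real.pi / 2) :
    0 < (I * Complex.exp (-(2 * α) * I)).re := by
  have : (-(2 * α) * I : ℂ) = ((-(2 * α) : ℝ) : ℂ) * I := by push_cast; rfl
  rw [this, I_mul_re, exp_ofReal_mul_I_im, Real.sin_neg, neg_neg]
  exact Real.sin_pos_of_pos_of_lt_pi (by linarith) (by linarith)

/-- Away from the real axis, the double exponential integral reduces to an absolutely convergent
integral against the homogeneous kernel. -/
theorem integral_exp_mul_laplace_eq {α : ℝ} (h0 : 0 < α) (h1 : α < Real.pi / 2) {u : ℝ → ℂ}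
    (hu : IntegrableOn u (Set.Ioi 0)) {x : ℝ} (hx : 0 < x) :
    (2 * Real.pi : ℂ)⁻¹ * ∫ ξ : ℝ in Set.Ioi 0,
        Complex.exp (-(ξ * (x * (I * Complex.exp (-(2 * α) * I))))) *
          ∫ y : ℝ in Set.Ioi 0, Complex.exp (-(I * ξ * y)) * u y =
      ∫ t : ℝ in Set.Ioi 0, rotKernel α t * u (x * t) := by
  have hw := rot_re_pos h0 h1
  set w := I * Complex.exp (-(2 * α) * I) with hwdef
  have hint : Integrable (fun p : ℝ × ℝ =>
      Complex.exp (-(p.1 * (x * w))) * (Complex.exp (-(I * p.1 * p.2)) * u p.2))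
      ((volume.restrict (Set.Ioi (0 : ℝ))).prod (volume.restrict (Set.Ioi (0 : ℝ)))) := by
    have hE : IntegrableOn (fun ξ : ℝ => Complex.exp ((-(x * w)) * ξ)) (Set.Ioi 0) :=
      integrableOn_exp_mul_complex_Ioi (by simp; positivity) 0
    have h := hE.mul_prod hu
    have h2 := h.bdd_mul (f := fun p : ℝ × ℝ => Complex.exp (-(I * p.1 * p.2))) (c := 1)
      (by fun_prop) (ae_of_all _ fun p => by simp [norm_exp])
    refine h2.congr (ae_of_all _ fun p => ?_)
    simp only
    rw [mul_left_comm]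
    congr 3
    ring
  calc _ = (2 * Real.pi : ℂ)⁻¹ * ∫ ξ : ℝ in Set.Ioi 0, ∫ y : ℝ in Set.Ioi 0,
        Complex.exp (-(ξ * (x * w))) * (Complex.exp (-(I * ξ * y)) * u y) := by
        simp only [integral_const_mul]
    _ = (2 * Real.pi : ℂ)⁻¹ * ∫ y : ℝ in Set.Ioi 0, ∫ ξ : ℝ in Set.Ioi 0,
        Complex.exp (-(ξ * (x * w))) * (Complex.exp (-(I * ξ * y)) * u y) := by
        rw [integral_integral_swap hint]
    _ = (2 * Real.pi : ℂ)⁻¹ * ∫ y : ℝ in Set.Ioi 0, (1 / (x * w + I * y)) * u y := by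
        congr 1
        refine setIntegral_congr_fun measurableSet_Ioi fun y hy => ?_
        have e : ∀ ξ : ℝ, Complex.exp (-(ξ * (x * w))) * (Complex.exp (-(I * ξ * y)) * u y) =
            Complex.exp (-(ξ * (x * w + I * y))) * u y := by
          intro ξ
          rw [← mul_assoc, ← Complex.exp_add]
          ring_nf
        simp only [e]
        rw [integral_mul_const, integral_exp_neg_mul_Ioi_complex (by simp; positivity)]
    _ = (2 * Real.pi : ℂ)⁻¹ * (x * ∫ t : ℝ in Set.Ioi 0,
          (1 / (x * w + I * ((x * t : ℝ) : ℂ))) * u (x * t)) := by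
        have := integral_comp_mul_left_Ioi (fun y : ℝ => (1 / (x * w + I * y)) * u y) 0 hx
        rw [this, mul_zero, Complex.real_smul, ofReal_inv,
          mul_inv_cancel_left₀ (by exact_mod_cast hx.ne')]
    _ = _ := by
        rw [← mul_assoc, ← integral_const_mul]
        refine setIntegral_congr_fun measurableSet_Ioi fun t ht => ?_
        have hx' : (x : ℂ) ≠ 0 := by exact_mod_cast hx.ne'
        have : (x * w + I * ((x * t : ℝ) : ℂ)) = x * (w + I * t) := by push_cast; ring
        simp only [this]
        rw [rotKernel, ← hwdef, one_div, mul_inv, one_div]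
        push_cast
        field_simp

theorem integrable_laplace_of_contDiff {u : ℝ → ℂ} (hu : ContDiff ℝ (⊤ : ℕ∞) u)
    (hc : HasCompactSupport u) (h0 : ∀ x ≤ 0, u x = 0) :
    Integrable (fun ξ : ℝ => ∫ y : ℝ in Set.Ioi 0, Complex.exp (-(I * ξ * y)) * u y) := by
  have h := (FourierTransform.fourier (hc.toSchwartzMap hu)).integrable (μ := volume)
  have h2 := h.comp_div (R := (2 * Real.pi)) (by positivity)
  refine h2.congr (ae_of_all _ fun ξ => ?_)
  simp only [SchwartzMap.fourier_coe]
  rw [Real.fourier_eq', setIntegral_eq_integral_of_forall_compl_eq_zero]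
  · refine integral_congr_ae (ae_of_all _ fun y => ?_)
    simp only [smul_eq_mul]
    congr 2
    simp
    have : (Real.pi : ℂ) ≠ 0 := by exact_mod_cast Real.pi_ne_zero
    field_simp
  · intro y hy
    rw [h0 y (by simpa using hy), mul_zero]

theorem tendsto_integral_mul_laplace {v h : ℝ → ℂ} (hv : IntegrableOn v (Set.Ioi 0))
    (hh : IntegrableOn h (Set.Ioi 0)) :
    Filter.Tendsto (fun α : ℝ => ∫ x : ℝ in Set.Ioi 0, v x * ∫ ξ : ℝ in Set.Ioi 0,
        Complex.exp (-(ξ * (x * (I * Complex.exp (-(2 * α) * I))))) * h ξ)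
      (nhdsWithin (Real.pi / 2) (Set.Iio (Real.pi / 2)))
      (nhds (∫ x : ℝ in Set.Ioi 0, v x * ∫ ξ : ℝ in Set.Ioi 0,
        Complex.exp (I * ξ * x) * h ξ)) := by
  set μ := (volume.restrict (Set.Ioi (0 : ℝ))).prod (volume.restrict (Set.Ioi (0 : ℝ)))
  have hprod : Integrable (fun p : ℝ × ℝ => v p.1 * h p.2) μ := Integrable.mul_prod hv hh
  have hpos : ∀ᵐ p ∂μ, 0 < p.1 ∧ 0 < p.2 := by
    rw [show μ = _ from Measure.prod_restrict _ _]
    filter_upwards [ae_restrict_mem (measurableSet_Ioi.prod measurableSet_Ioi)] with p hp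
    exact hp
  have hmeas : ∀ e : ℝ × ℝ → ℂ, Continuous e → AEStronglyMeasurable
      (fun p : ℝ × ℝ => Complex.exp (e p) * (v p.1 * h p.2)) μ := fun e he =>
    AEStronglyMeasurable.mul (he.cexp.aestronglyMeasurable) hprod.aestronglyMeasurable
  have hIoo : ∀ᶠ α in nhdsWithin (Real.pi / 2) (Set.Iio (Real.pi / 2)),
      α ∈ Set.Ioo 0 (Real.pi / 2) := Ioo_mem_nhdsLT (by positivity)
  have hbd : ∀ α ∈ Set.Ioo 0 (Real.pi / 2), ∀ᵐ p ∂μ,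
      ‖Complex.exp (-(p.2 * (p.1 * (I * Complex.exp (-(2 * α) * I))))) * (v p.1 * h p.2)‖ ≤
        ‖v p.1 * h p.2‖ := by
    intro α hα
    filter_upwards [hpos] with p hp
    rw [norm_mul]
    refine mul_le_of_le_one_left (norm_nonneg _) ?_
    rw [norm_exp, Real.exp_le_one_iff, neg_re, re_ofReal_mul, re_ofReal_mul, neg_nonpos]
    exact mul_nonneg hp.2.le (mul_nonneg hp.1.le (rot_re_pos hα.1 hα.2).le)
  have key : Filter.Tendsto (fun α : ℝ => ∫ p,
        Complex.exp (-(p.2 * (p.1 * (I * Complex.exp (-(2 * α) * I))))) * (v p.1 * h p.2) ∂μ)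
      (nhdsWithin (Real.pi / 2) (Set.Iio (Real.pi / 2)))
      (nhds (∫ p, Complex.exp (I * p.2 * p.1) * (v p.1 * h p.2) ∂μ)) := by
    refine tendsto_integral_filter_of_dominated_convergence (fun p => ‖v p.1 * h p.2‖) ?_ ?_
      hprod.norm ?_
    · exact Filter.Eventually.of_forall fun α => hmeas _ (by fun_prop)
    · filter_upwards [hIoo] with α hα using hbd α hα
    · refine ae_of_all _ fun p => ?_
      have hcont : Continuous (fun α : ℝ =>
          Complex.exp (-(p.2 * (p.1 * (I * Complex.exp (-(2 * α) * I))))) * (v p.1 * h p.2)) := by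
        fun_prop
      have hval : Complex.exp (-(p.2 * (p.1 * (I * Complex.exp
          (-(2 * ((Real.pi / 2 : ℝ) : ℂ)) * I))))) = Complex.exp (I * p.2 * p.1) := by
        have : (-(2 * ((Real.pi / 2 : ℝ) : ℂ)) * I) = -(Real.pi * I) := by push_cast; ring
        rw [this, Complex.exp_neg (Real.pi * I), Complex.exp_pi_mul_I]
        congr 1
        norm_num
        ring
      have := (hcont.tendsto (Real.pi / 2)).mono_left
        (nhdsWithin_le_nhds (s := Set.Iio (Real.pi / 2)))
      rwa [hval] at this
  have hiter : ∀ e : ℝ × ℝ → ℂ,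
      Integrable (fun p : ℝ × ℝ => Complex.exp (e p) * (v p.1 * h p.2)) μ →
      ∫ p, Complex.exp (e p) * (v p.1 * h p.2) ∂μ =
        ∫ x : ℝ in Set.Ioi 0, v x * ∫ ξ : ℝ in Set.Ioi 0, Complex.exp (e (x, ξ)) * h ξ := by
    intro e he
    rw [integral_prod _ he]
    simp only [← integral_const_mul]
    congr! 4
    ring
  rw [hiter (fun p => I * p.2 * p.1)] at key
  · refine key.congr' ?_
    filter_upwards [hIoo] with α hα
    exact hiter _ (hprod.norm.mono' (hmeas _ (by fun_prop)) (hbd α hα))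
  · refine hprod.norm.mono' (hmeas _ (by fun_prop)) (ae_of_all _ fun p => ?_)
    rw [norm_mul, norm_exp]
    simp

theorem continuous_rotKernel {α : ℝ} (h0 : 0 < α) (h1 : α < Real.pi / 2) :
    Continuous (rotKernel α) := by
  unfold rotKernel
  have : ∀ t : ℝ, I * Complex.exp (-(2 * α) * I) + I * t ≠ 0 := by
    intro t h
    have h2 := congrArg re h
    have := rot_re_pos h0 h1
    simp only [add_re, zero_re, re_mul_ofReal, I_re, zero_mul, add_zero] at h2
    linarith
  fun_prop (disch := exact this _)

theorem integral_mul_dilation_swap {α : ℝ} (h0 : 0 < α) (h1 : α < Real.pi / 2) {u v : ℝ → ℂ}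
    (hu : Continuous u) (huc : HasCompactSupport u) (hv : Continuous v) (hvc : HasCompactSupport v)
    (hv0 : tsupport v ⊆ Set.Ioi 0) :
    ∫ x : ℝ in Set.Ioi 0, v x * ∫ t : ℝ in Set.Ioi 0, rotKernel α t * u (x * t) =
      ∫ t : ℝ in Set.Ioi 0, rotKernel α t * ∫ x : ℝ in Set.Ioi 0, v x * u (x * t) := by
  have hcont : Continuous (fun p : ℝ × ℝ => v p.1 * (rotKernel α p.2 * u (p.1 * p.2))) := by
    have := continuous_rotKernel h0 h1
    fun_prop
  have hcomp : HasCompactSupport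
      (fun p : ℝ × ℝ => v p.1 * (rotKernel α p.2 * u (p.1 * p.2))) := by
    have hdiv : ContinuousOn (fun q : ℝ × ℝ => (q.1, q.2 / q.1)) (tsupport v ×ˢ tsupport u) := by
      refine continuousOn_fst.prodMk (continuousOn_snd.div continuousOn_fst fun q hq => ?_)
      exact (hv0 hq.1).ne'
    refine HasCompactSupport.of_support_subset_isCompact
      ((IsCompact.prod hvc huc).image_of_continuousOn hdiv) fun p hp => ?_
    have hp1 : v p.1 ≠ 0 := fun h => hp (by simp [h])
    have hp2 : u (p.1 * p.2) ≠ 0 := fun h => hp (by simp [h])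
    have hm1 := subset_tsupport v hp1
    refine ⟨(p.1, p.1 * p.2), ⟨hm1, subset_tsupport u hp2⟩, ?_⟩
    have : p.1 ≠ 0 := (hv0 hm1).ne'
    ext <;> simp [this]
  have hint : Integrable (fun p : ℝ × ℝ => v p.1 * (rotKernel α p.2 * u (p.1 * p.2)))
      ((volume.restrict (Set.Ioi (0 : ℝ))).prod (volume.restrict (Set.Ioi (0 : ℝ)))) := by
    rw [Measure.prod_restrict]
    exact (hcont.integrable_of_hasCompactSupport hcomp).integrableOn
  simp only [← integral_const_mul]
  rw [integral_integral_swap hint]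
  congr! 4
  ring

theorem integral_mul_dilation_eq
    (M : Lp ℂ 2 (volume.restrict (Set.Ioi (0:ℝ))) ≃ₗᵢ[ℂ] Lp ℂ 2 (volume : Measure ℝ))
    (hM : ∀ u : ℝ → ℂ, Continuous u → HasCompactSupport u →
      (∀ x : ℝ, x ≤ 0 → u x = 0) →
      ∀ U : Lp ℂ 2 (volume.restrict (Set.Ioi (0:ℝ))),
        (⇑U =ᵐ[volume.restrict (Set.Ioi (0:ℝ))] u) →
        ⇑(M U) =ᵐ[(volume : Measure ℝ)]
          fun s : ℝ => (Real.sqrt (2*Real.pi))⁻¹ •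
            ∫ x in Set.Ioi (0:ℝ), (x:ℂ) ^ (-(1/2 : ℂ) + Complex.I * (s:ℂ)) * u x)
    {u : ℝ → ℂ} (hu : Continuous u) (huc : HasCompactSupport u) (hu0 : ∀ x ≤ 0, u x = 0)
    {v : ℝ → ℝ} {U V : Lp ℂ 2 (volume.restrict (Set.Ioi (0:ℝ)))}
    (hU : ⇑U =ᵐ[volume.restrict (Set.Ioi (0:ℝ))] u)
    (hV : ⇑V =ᵐ[volume.restrict (Set.Ioi (0:ℝ))] fun x => (v x : ℂ)) {t : ℝ} (ht : 0 < t) :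
    ∫ x in Set.Ioi (0:ℝ), (v x : ℂ) * u (x * t) =
      ∫ s : ℝ, (t : ℂ) ^ (-(1 / 2 + I * s)) * inner ℂ (M V s) (M U s) := by
  have htc : Continuous (fun x => u (t * x)) := by fun_prop
  have htcs : HasCompactSupport (fun x => u (t * x)) :=
    huc.comp_homeomorph (Homeomorph.mulLeft₀ t ht.ne')
  have hmem : MemLp (fun x => u (t * x)) 2 (volume.restrict (Set.Ioi (0:ℝ))) :=
    (htc.memLp_of_hasCompactSupport htcs).restrict _
  have hUt := hmem.coeFn_toLp
  set Ut := hmem.toLp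
  have hMU := hM u hu huc hu0 U hU
  have hMUt := hM _ htc htcs (fun x hx => hu0 _ (mul_nonpos_of_nonneg_of_nonpos ht.le hx)) Ut hUt
  have hinner : ∫ x in Set.Ioi (0:ℝ), (v x : ℂ) * u (x * t) = inner ℂ V Ut := by
    rw [L2.inner_def]
    refine integral_congr_ae ?_
    filter_upwards [hV, hUt] with x hx hx'
    rw [hx, hx', RCLike.inner_apply, conj_ofReal, mul_comm x t, mul_comm]
  rw [hinner, ← M.inner_map_map, L2.inner_def]
  refine integral_congr_ae ?_
  filter_upwards [hMU, hMUt] with s hs hs'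
  have hscale : ∫ x in Set.Ioi (0:ℝ), (x:ℂ) ^ (-(1/2 : ℂ) + I * (s:ℂ)) * u (t * x) =
      (t : ℂ) ^ (-(1 / 2 + I * s)) *
        ∫ x in Set.Ioi (0:ℝ), (x:ℂ) ^ (-(1/2 : ℂ) + I * (s:ℂ)) * u x := by
    have h := mellin_comp_mul_left u (1 / 2 + I * s) ht
    simp only [mellin, smul_eq_mul] at h
    have e : (1 / 2 + I * s - 1 : ℂ) = -(1 / 2) + I * s := by ring
    rwa [e] at h
  have : M Ut s = (t : ℂ) ^ (-(1 / 2 + I * s)) * M U s := by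
    rw [hs, hs', hscale, mul_smul_comm]
  rw [this, ← smul_eq_mul, inner_smul_right]

theorem integral_rotKernel_mul_eq {α : ℝ} (h0 : 0 < α) (h1 : α < Real.pi / 2) {G : ℝ → ℂ}
    (hG : Integrable G) :
    ∫ t : ℝ in Set.Ioi 0, rotKernel α t * ∫ s : ℝ, (t : ℂ) ^ (-(1 / 2 + I * s)) * G s =
      ∫ s : ℝ, rotSymbol α s * G s := by
  have hk := continuous_rotKernel h0 h1
  have hint : Integrable (fun p : ℝ × ℝ =>
      rotKernel α p.1 * ((p.1 : ℂ) ^ (-(1 / 2 + I * p.2)) * G p.2))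
      ((volume.restrict (Set.Ioi (0 : ℝ))).prod volume) := by
    have hpos : ∀ᵐ p ∂((volume.restrict (Set.Ioi (0 : ℝ))).prod (volume : Measure ℝ)),
        0 < p.1 := by
      have : (volume.restrict (Set.Ioi (0 : ℝ))).prod (volume : Measure ℝ) =
          (volume.prod volume).restrict (Set.Ioi 0 ×ˢ Set.univ) := by
        rw [← Measure.prod_restrict, Measure.restrict_univ]
      rw [this]
      filter_upwards [ae_restrict_mem (measurableSet_Ioi.prod MeasurableSet.univ)] with p hp
      exact hp.1
    refine ((integrableOn_cpow_mul_rotKernel h0 h1 0).mul_prod hG).mono ?_ ?_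
    · refine AEStronglyMeasurable.mul (by fun_prop) (AEStronglyMeasurable.mul ?_
        hG.aestronglyMeasurable.comp_snd)
      exact Measurable.aestronglyMeasurable (by fun_prop)
    · filter_upwards [hpos] with p hp
      simp only [norm_mul, norm_cpow_eq_rpow_re_of_pos hp]
      simp
      apply le_of_eq
      ring
  simp only [← integral_const_mul]
  rw [integral_integral_swap hint]
  refine integral_congr_ae (ae_of_all _ fun s => ?_)
  simp only
  rw [← integral_cpow_mul_rotKernel h0 h1 s, ← integral_mul_const]
  congr! 2
  ring

/-- The weak form of the diagonalization, tested against real smooth functions. -/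
theorem inner_wienerHopf_eq
    (T : Lp ℂ 2 (volume.restrict (Set.Ioi (0:ℝ))) →L[ℂ]
          Lp ℂ 2 (volume.restrict (Set.Ioi (0:ℝ))))
    (M : Lp ℂ 2 (volume.restrict (Set.Ioi (0:ℝ))) ≃ₗᵢ[ℂ] Lp ℂ 2 (volume : Measure ℝ))
    (hT : ∀ u : ℝ → ℂ, ContDiff ℝ (⊤ : ℕ∞) u → HasCompactSupport u →
      (∀ x : ℝ, x ≤ 0 → u x = 0) →
      ∀ U : Lp ℂ 2 (volume.restrict (Set.Ioi (0:ℝ))),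
        (⇑U =ᵐ[volume.restrict (Set.Ioi (0:ℝ))] u) →
        ⇑(T U) =ᵐ[volume.restrict (Set.Ioi (0:ℝ))]
          fun x : ℝ => (2*Real.pi)⁻¹ •
            ∫ ξ in Set.Ioi (0:ℝ), ∫ y in Set.Ioi (0:ℝ),
              Complex.exp (Complex.I * (ξ:ℂ) * ((x:ℂ) - (y:ℂ))) * u y)
    (hM : ∀ u : ℝ → ℂ, Continuous u → HasCompactSupport u →
      (∀ x : ℝ, x ≤ 0 → u x = 0) →
      ∀ U : Lp ℂ 2 (volume.restrict (Set.Ioi (0:ℝ))),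
        (⇑U =ᵐ[volume.restrict (Set.Ioi (0:ℝ))] u) →
        ⇑(M U) =ᵐ[(volume : Measure ℝ)]
          fun s : ℝ => (Real.sqrt (2*Real.pi))⁻¹ •
            ∫ x in Set.Ioi (0:ℝ), (x:ℂ) ^ (-(1/2 : ℂ) + Complex.I * (s:ℂ)) * u x)
    {u : ℝ → ℂ} (hu : ContDiff ℝ (⊤ : ℕ∞) u) (huc : HasCompactSupport u)
    (hu0 : ∀ x ≤ 0, u x = 0)
    {v : ℝ → ℝ} (hv : Continuous v) (hvc : HasCompactSupport v) (hv0 : tsupport v ⊆ Set.Ioi 0)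
    {U V : Lp ℂ 2 (volume.restrict (Set.Ioi (0:ℝ)))}
    (hU : ⇑U =ᵐ[volume.restrict (Set.Ioi (0:ℝ))] u)
    (hV : ⇑V =ᵐ[volume.restrict (Set.Ioi (0:ℝ))] fun x => (v x : ℂ)) :
    inner ℂ V (T U) =
      ∫ s : ℝ, (((1 + Real.exp (2*Real.pi*s))⁻¹ : ℝ) : ℂ) * inner ℂ (M V s) (M U s) := by
  set F : Filter ℝ := nhdsWithin (Real.pi / 2) (Set.Iio (Real.pi / 2)) with hF
  have hIoo : ∀ᶠ α in F, α ∈ Set.Ioo 0 (Real.pi / 2) := Ioo_mem_nhdsLT (by positivity)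
  have hcv : Continuous (fun x => (v x : ℂ)) := by fun_prop
  have hcvc : HasCompactSupport (fun x => (v x : ℂ)) := hvc.comp_left (g := ofReal) rfl
  have hcv0 : tsupport (fun x => (v x : ℂ)) ⊆ Set.Ioi 0 := by
    refine subset_trans (closure_mono fun x hx => ?_) hv0
    simpa using hx
  have hui : IntegrableOn u (Set.Ioi 0) :=
    (hu.continuous.integrable_of_hasCompactSupport huc).integrableOn
  have hG : Integrable (fun s : ℝ => inner ℂ (M V s) (M U s)) := L2.integrable_inner _ _
  have hright : Filter.Tendsto (fun α => ∫ s : ℝ, rotSymbol α s * inner ℂ (M V s) (M U s)) F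
      (nhds (∫ s : ℝ, (((1 + Real.exp (2*Real.pi*s))⁻¹ : ℝ) : ℂ) * inner ℂ (M V s) (M U s))) := by
    refine tendsto_integral_filter_of_dominated_convergence
      (fun s : ℝ => ‖inner ℂ (M V s) (M U s)‖) ?_ ?_ hG.norm ?_
    · exact Filter.Eventually.of_forall fun α =>
        (continuous_rotSymbol α).aestronglyMeasurable.mul hG.aestronglyMeasurable
    · filter_upwards [hIoo] with α hα
      refine ae_of_all _ fun s => ?_
      rw [norm_mul]
      exact mul_le_of_le_one_left (norm_nonneg _) (norm_rotSymbol_le hα.1 hα.2 s)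
    · exact ae_of_all _ fun s => (tendsto_rotSymbol s).mul_const _
  have hleft := (tendsto_integral_mul_laplace
    (hcv.integrable_of_hasCompactSupport hcvc).integrableOn
    (integrable_laplace_of_contDiff hu huc hu0).integrableOn).const_mul (2 * Real.pi : ℂ)⁻¹
  have hL : inner ℂ V (T U) = (2 * Real.pi : ℂ)⁻¹ * ∫ x : ℝ in Set.Ioi 0, (v x : ℂ) *
      ∫ ξ : ℝ in Set.Ioi 0, Complex.exp (I * ξ * x) *
        ∫ y : ℝ in Set.Ioi 0, Complex.exp (-(I * ξ * y)) * u y := by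
    rw [L2.inner_def, ← integral_const_mul]
    refine integral_congr_ae ?_
    filter_upwards [hV, hT u hu huc hu0 U hU] with x hx hx'
    rw [hx, hx', RCLike.inner_apply, conj_ofReal, Complex.real_smul]
    have e : ∀ ξ y : ℝ, Complex.exp (I * ξ * (x - y)) * u y =
        Complex.exp (I * ξ * x) * (Complex.exp (-(I * ξ * y)) * u y) := by
      intro ξ y
      rw [← mul_assoc, ← Complex.exp_add]
      ring_nf
    simp only [e, integral_const_mul]
    push_cast
    ring
  rw [hL]
  refine tendsto_nhds_unique hleft (hright.congr' ?_)
  filter_upwards [hIoo] with α hα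
  calc ∫ s : ℝ, rotSymbol α s * inner ℂ (M V s) (M U s)
      = ∫ t : ℝ in Set.Ioi 0, rotKernel α t *
          ∫ s : ℝ, (t : ℂ) ^ (-(1 / 2 + I * s)) * inner ℂ (M V s) (M U s) :=
        (integral_rotKernel_mul_eq hα.1 hα.2 hG).symm
    _ = ∫ t : ℝ in Set.Ioi 0, rotKernel α t * ∫ x in Set.Ioi (0:ℝ), (v x : ℂ) * u (x * t) := by
        refine setIntegral_congr_fun measurableSet_Ioi fun t ht => ?_
        rw [integral_mul_dilation_eq M hM hu.continuous huc hu0 hU hV ht]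
    _ = ∫ x : ℝ in Set.Ioi 0, (v x : ℂ) * ∫ t : ℝ in Set.Ioi 0, rotKernel α t * u (x * t) :=
        (integral_mul_dilation_swap hα.1 hα.2 hu.continuous huc hcv hcvc hcv0).symm
    _ = _ := by
        rw [← integral_const_mul]
        refine setIntegral_congr_fun measurableSet_Ioi fun x hx => ?_
        rw [← integral_exp_mul_laplace_eq hα.1 hα.2 hui hx]
        ring

theorem eq_zero_of_inner_contDiff_eq_zero (W : Lp ℂ 2 (volume.restrict (Set.Ioi (0:ℝ))))
    (h : ∀ (V : Lp ℂ 2 (volume.restrict (Set.Ioi (0:ℝ)))) (v : ℝ → ℝ), ContDiff ℝ (⊤ : ℕ∞) v →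
      HasCompactSupport v → tsupport v ⊆ Set.Ioi 0 →
      ⇑V =ᵐ[volume.restrict (Set.Ioi (0:ℝ))] (fun x => (v x : ℂ)) → inner ℂ V W = 0) :
    W = 0 := by
  have hloc : LocallyIntegrable W (volume.restrict (Set.Ioi (0:ℝ))) :=
    (Lp.memLp W).locallyIntegrable (by norm_num)
  suffices hae : ∀ᵐ x ∂(volume.restrict (Set.Ioi (0:ℝ))), x ∈ Set.Ioi 0 → W x = 0 by
    refine Lp.ext ?_
    filter_upwards [hae, ae_restrict_mem measurableSet_Ioi, Lp.coeFn_zero ℂ 2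
      (volume.restrict (Set.Ioi (0:ℝ)))] with x hx hx' hx0
    rw [hx hx', hx0]
    rfl
  refine isOpen_Ioi.ae_eq_zero_of_integral_contDiff_smul_eq_zero (hloc.locallyIntegrableOn _)
    (fun v hv hvc hv0 => ?_)
  have hmem : MemLp (fun x => (v x : ℂ)) 2 (volume.restrict (Set.Ioi (0:ℝ))) :=
    ((continuous_ofReal.comp hv.continuous).memLp_of_hasCompactSupport
      (hvc.comp_left (g := ofReal) rfl)).restrict _
  rw [← h hmem.toLp v hv hvc hv0 hmem.coeFn_toLp, L2.inner_def]
  refine integral_congr_ae ?_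
  filter_upwards [hmem.coeFn_toLp] with x hx
  rw [hx, RCLike.inner_apply, conj_ofReal, mul_comm, Complex.real_smul]

theorem dense_span_contDiff :
    Dense (Submodule.span ℂ {V : Lp ℂ 2 (volume.restrict (Set.Ioi (0:ℝ))) |
      ∃ v : ℝ → ℝ, ContDiff ℝ (⊤ : ℕ∞) v ∧ HasCompactSupport v ∧ tsupport v ⊆ Set.Ioi 0 ∧
        ⇑V =ᵐ[volume.restrict (Set.Ioi (0:ℝ))] (fun x => (v x : ℂ))} :
      Set (Lp ℂ 2 (volume.restrict (Set.Ioi (0:ℝ))))) := by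
  rw [Submodule.dense_iff_topologicalClosure_eq_top, Submodule.topologicalClosure_eq_top_iff,
    Submodule.eq_bot_iff]
  intro W hW
  refine eq_zero_of_inner_contDiff_eq_zero W fun V v hv hvc hv0 hV => ?_
  exact (Submodule.mem_orthogonal _ _).mp hW V (Submodule.subset_span ⟨v, hv, hvc, hv0, hV⟩)

theorem exists_clm_ae_eq_mul {g : ℝ → ℂ} (hg : Continuous g) {C : ℝ} (hC : ∀ s, ‖g s‖ ≤ C) :
    ∃ A : Lp ℂ 2 (volume : Measure ℝ) →L[ℂ] Lp ℂ 2 (volume : Measure ℝ),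
      ∀ f, ⇑(A f) =ᵐ[volume] fun s => g s * f s := by
  have hmem : MemLp g ⊤ (volume : Measure ℝ) :=
    memLp_top_of_bound hg.aestronglyMeasurable C (ae_of_all _ hC)
  refine ⟨(ContinuousLinearMap.mul ℂ ℂ).holderL volume ⊤ 2 2 hmem.toLp, fun f => ?_⟩
  filter_upwards [(ContinuousLinearMap.mul ℂ ℂ).coeFn_holder (r := 2) hmem.toLp f,
    hmem.coeFn_toLp] with s hs hs'
  rw [← hs']
  exact hs

theorem spectrum_eq_closure_range_of_ae_eq_mul {g : ℝ → ℂ} (hg : Continuous g)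
    {A : Lp ℂ 2 (volume : Measure ℝ) →L[ℂ] Lp ℂ 2 (volume : Measure ℝ)}
    (hA : ∀ f, ⇑(A f) =ᵐ[volume] fun s => g s * f s) :
    spectrum ℂ A = closure (Set.range g) := by
  have hsub : ∀ (z : ℂ) (f : Lp ℂ 2 (volume : Measure ℝ)),
      ⇑((algebraMap ℂ (Lp ℂ 2 (volume : Measure ℝ) →L[ℂ] Lp ℂ 2 (volume : Measure ℝ)) z - A) f)
      =ᵐ[volume] fun s => (z - g s) * f s := by
    intro z f
    have : (algebraMap ℂ (Lp ℂ 2 (volume : Measure ℝ) →L[ℂ] Lp ℂ 2 (volume : Measure ℝ)) z - A) f =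
        z • f - A f := by
      simp [Algebra.algebraMap_eq_smul_one]
    rw [this]
    filter_upwards [Lp.coeFn_sub (z • f) (A f), Lp.coeFn_smul z f, hA f] with s h1 h2 h3
    rw [h1, Pi.sub_apply, h2, h3, Pi.smul_apply, smul_eq_mul, sub_mul]
  ext z
  constructor
  · intro hz
    by_contra hcl
    refine hz ?_
    obtain ⟨ε, hε, hball⟩ := Metric.mem_nhds_iff.mp (isClosed_closure.isOpen_compl.mem_nhds hcl)
    have hle : ∀ s, ε ≤ ‖z - g s‖ := by
      intro s
      by_contra! hlt
      refine hball (Metric.mem_ball.mpr ?_) (subset_closure (Set.mem_range_self s))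
      rwa [dist_comm, dist_eq_norm]
    have hne : ∀ s, z - g s ≠ 0 := fun s h => by
      have := hle s
      rw [h, norm_zero] at this
      linarith
    obtain ⟨B, hB⟩ := exists_clm_ae_eq_mul (g := fun s => (z - g s)⁻¹) (C := ε⁻¹)
      (by fun_prop (disch := exact hne _))
      (fun s => by rw [norm_inv]; exact inv_anti₀ hε (hle s))
    refine ⟨⟨_, B, ?_, ?_⟩, rfl⟩
    · ext1 f
      refine Lp.ext ?_
      filter_upwards [hsub z (B f), hB f] with s h1 h2
      rw [mul_apply_eq_comp, h1, h2, mul_inv_cancel_left₀ (hne s)]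
      rfl
    · ext1 f
      refine Lp.ext ?_
      filter_upwards [hsub z f,
        hB ((algebraMap ℂ (Lp ℂ 2 (volume : Measure ℝ) →L[ℂ] Lp ℂ 2 (volume : Measure ℝ)) z - A) f)] with s h1 h2
      rw [mul_apply_eq_comp, h2, h1, inv_mul_cancel_left₀ (hne s)]
      rfl
  · rintro hcl ⟨⟨D, B, hDB, hBD⟩, hD⟩
    simp only at hD
    subst hD
    set D := (algebraMap ℂ (Lp ℂ 2 (volume : Measure ℝ) →L[ℂ] Lp ℂ 2 (volume : Measure ℝ)) z - A)
    set ε : ℝ := (‖B‖ + 1)⁻¹ with hεdef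
    have hε : 0 < ε := by positivity
    obtain ⟨_, ⟨s₀, rfl⟩, hs₀⟩ := Metric.mem_closure_iff.mp hcl ε hε
    have hopen : IsOpen {s | ‖z - g s‖ < ε} := isOpen_lt (by fun_prop) continuous_const
    obtain ⟨δ, hδ, hball⟩ := Metric.isOpen_iff.mp hopen s₀ (by simpa [dist_eq_norm] using hs₀)
    have hfin : volume (Metric.ball s₀ δ) ≠ ⊤ := measure_ball_lt_top.ne
    set f := indicatorConstLp 2 (Metric.isOpen_ball (x := s₀) (ε := δ)).measurableSet hfin (1 : ℂ)
      with hf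
    have hfpos : 0 < ‖f‖ := by
      rw [hf, norm_indicatorConstLp (by norm_num) (by norm_num), norm_one, one_mul]
      refine Real.rpow_pos_of_pos ?_ _
      exact ENNReal.toReal_pos (Metric.measure_ball_pos _ _ hδ).ne' hfin
    have hDf : ‖D f‖ ≤ ε * ‖f‖ := by
      refine Lp.norm_le_mul_norm_of_ae_le_mul ?_
      filter_upwards [hsub z f, indicatorConstLp_coeFn (p := 2) (hs :=
        (Metric.isOpen_ball (x := s₀) (ε := δ)).measurableSet) (hμs := hfin) (c := (1 : ℂ))]
        with s h1 h2
      rw [h1, norm_mul]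
      by_cases hs : s ∈ Metric.ball s₀ δ
      · exact mul_le_mul_of_nonneg_right (hball hs).le (norm_nonneg _)
      · rw [h2, Set.indicator_of_notMem hs]
        simp
    have hBf : ‖f‖ ≤ ‖B‖ * ‖D f‖ := by
      have : B (D f) = f := congrArg (fun L : _ →L[ℂ] _ => L f) hBD
      calc ‖f‖ = ‖B (D f)‖ := by rw [this]
        _ ≤ _ := B.le_opNorm _
    have hlt : ‖B‖ * ε < 1 := by
      rw [hεdef, ← div_eq_mul_inv, div_lt_one (by positivity)]
      linarith
    have : ‖B‖ * ‖D f‖ ≤ ‖B‖ * ε * ‖f‖ := by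
      rw [mul_assoc]
      exact mul_le_mul_of_nonneg_left hDf (norm_nonneg _)
    nlinarith

theorem range_inv_one_add_exp :
    Set.range (fun s : ℝ => (1 + Real.exp (2*Real.pi*s))⁻¹) = Set.Ioo 0 1 := by
  ext r
  constructor
  · rintro ⟨s, rfl⟩
    exact ⟨by positivity, inv_lt_one_of_one_lt₀ (by linarith [Real.exp_pos (2*Real.pi*s)])⟩
  · rintro ⟨h0, h1⟩
    have hpos : 0 < r⁻¹ - 1 := sub_pos.mpr ((one_lt_inv₀ h0).mpr h1)
    refine ⟨Real.log (r⁻¹ - 1) / (2 * Real.pi), ?_⟩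
    have := Real.pi_pos
    simp only
    rw [mul_div_cancel₀ _ (by positivity), Real.exp_log hpos]
    simp

theorem injective_inv_one_add_exp :
    Function.Injective (fun s : ℝ => (1 + Real.exp (2*Real.pi*s))⁻¹) := by
  intro a b h
  have h1 := Real.exp_injective (add_left_cancel (inv_injective h))
  exact mul_left_cancel₀ (by positivity) h1

theorem closure_range_inv_one_add_exp :
    closure (Set.range (fun s : ℝ => (((1 + Real.exp (2*Real.pi*s))⁻¹ : ℝ) : ℂ))) =
      {z : ℂ | ∃ r : ℝ, r ∈ Set.Icc (0:ℝ) 1 ∧ z = (r:ℂ)} := by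
  have hr : Set.range (fun s : ℝ => (((1 + Real.exp (2*Real.pi*s))⁻¹ : ℝ) : ℂ)) =
      ofReal '' Set.Ioo 0 1 := by
    rw [← range_inv_one_add_exp, ← Set.range_comp]
    rfl
  rw [hr, isometry_ofReal.isClosedEmbedding.closure_image_eq, closure_Ioo zero_ne_one]
  ext z
  simp only [Set.mem_image, Set.mem_ofPred_eq, eq_comm]

/-- the model Wiener–Hopf operator `T₊` on `L²(ℝ₊)` (characterized by its
kernel formula on smooth compactly supported functions) is carried by the Mellin
transform `M` into multiplication by `s ↦ (1+e^{2πs})⁻¹`; consequently its spectrum is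
`[0,1]` and it has no eigenvalues. -/
theorem stmt_16
    (T : Lp ℂ 2 (volume.restrict (Set.Ioi (0:ℝ))) →L[ℂ]
          Lp ℂ 2 (volume.restrict (Set.Ioi (0:ℝ))))
    (M : Lp ℂ 2 (volume.restrict (Set.Ioi (0:ℝ))) ≃ₗᵢ[ℂ] Lp ℂ 2 (volume : Measure ℝ))
    (hT : ∀ u : ℝ → ℂ, ContDiff ℝ (⊤ : ℕ∞) u → HasCompactSupport u →
      (∀ x : ℝ, x ≤ 0 → u x = 0) →
      ∀ U : Lp ℂ 2 (volume.restrict (Set.Ioi (0:ℝ))),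
        (⇑U =ᵐ[volume.restrict (Set.Ioi (0:ℝ))] u) →
        ⇑(T U) =ᵐ[volume.restrict (Set.Ioi (0:ℝ))]
          fun x : ℝ => (2*Real.pi)⁻¹ •
            ∫ ξ in Set.Ioi (0:ℝ), ∫ y in Set.Ioi (0:ℝ),
              Complex.exp (Complex.I * (ξ:ℂ) * ((x:ℂ) - (y:ℂ))) * u y)
    (hM : ∀ u : ℝ → ℂ, Continuous u → HasCompactSupport u →
      (∀ x : ℝ, x ≤ 0 → u x = 0) →
      ∀ U : Lp ℂ 2 (volume.restrict (Set.Ioi (0:ℝ))),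
        (⇑U =ᵐ[volume.restrict (Set.Ioi (0:ℝ))] u) →
        ⇑(M U) =ᵐ[(volume : Measure ℝ)]
          fun s : ℝ => (Real.sqrt (2*Real.pi))⁻¹ •
            ∫ x in Set.Ioi (0:ℝ), (x:ℂ) ^ (-(1/2 : ℂ) + Complex.I * (s:ℂ)) * u x) :
    (∀ U, ⇑(M (T U)) =ᵐ[(volume : Measure ℝ)]
        fun s : ℝ => (((1 + Real.exp (2*Real.pi*s))⁻¹ : ℝ) : ℂ) * (M U) s)
    ∧ spectrum ℂ T = {z : ℂ | ∃ r : ℝ, r ∈ Set.Icc (0:ℝ) 1 ∧ z = (r:ℂ)}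
    ∧ (∀ (c : ℂ) (U : Lp ℂ 2 (volume.restrict (Set.Ioi (0:ℝ)))),
        T U = c • U → U = 0) := by
  have hcont : Continuous (fun s : ℝ => (((1 + Real.exp (2*Real.pi*s))⁻¹ : ℝ) : ℂ)) := by
    have : ∀ s : ℝ, 1 + Real.exp (2*Real.pi*s) ≠ 0 := fun s => by positivity
    fun_prop (disch := exact this _)
  have hbdd : ∀ s : ℝ, ‖(((1 + Real.exp (2*Real.pi*s))⁻¹ : ℝ) : ℂ)‖ ≤ 1 := by
    intro s
    rw [norm_real, Real.norm_of_nonneg (by positivity)]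
    exact inv_le_one_of_one_le₀ (by linarith [Real.exp_pos (2*Real.pi*s)])
  obtain ⟨A, hA⟩ := exists_clm_ae_eq_mul hcont hbdd
  have hcomp : (T : _ →L[ℂ] _) = (M.symm.toContinuousLinearEquiv : _ →L[ℂ] _) ∘L A ∘L
      (M.toContinuousLinearEquiv : _ →L[ℂ] _) := by
    refine ContinuousLinearMap.ext_on dense_span_contDiff ?_
    rintro U ⟨u, hu, huc, hu0, hU⟩
    rw [← sub_eq_zero]
    refine eq_zero_of_inner_contDiff_eq_zero _ fun V v hv hvc hv0 hV => ?_
    have hzero : ∀ x ≤ 0, (u x : ℂ) = 0 := fun x hx => by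
      rw [image_eq_zero_of_notMem_tsupport fun h => not_lt.mpr hx (hu0 h), ofReal_zero]
    have h1 := inner_wienerHopf_eq T M hT hM (u := fun x => (u x : ℂ))
      (ofRealCLM.contDiff.comp hu) (huc.comp_left (g := ofReal) rfl) hzero hv.continuous hvc hv0
      hU hV
    rw [inner_sub_right, h1, sub_eq_zero]
    have h2 : inner ℂ V (M.symm (A (M U))) = inner ℂ (M V) (A (M U)) := by
      rw [← M.inner_map_map, M.apply_symm_apply]
    refine Eq.trans ?_ h2.symm
    rw [L2.inner_def]
    refine integral_congr_ae ?_
    filter_upwards [hA (M U)] with s hs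
    rw [hs, ← smul_eq_mul _ (M U s), inner_smul_right]
  have hMT : ∀ U, M (T U) = A (M U) := fun U => by
    have := congrArg (fun L : _ →L[ℂ] _ => M (L U)) hcomp
    simpa using this
  refine ⟨fun U => by rw [hMT]; exact hA _, ?_, ?_⟩
  · have hconj : M.toContinuousLinearEquiv.conjContinuousAlgEquiv T = A := by
      ext1 f
      have := hMT (M.symm f)
      rw [M.apply_symm_apply] at this
      exact this
    rw [← AlgEquiv.spectrum_eq M.toContinuousLinearEquiv.conjContinuousAlgEquiv T, hconj,
      spectrum_eq_closure_range_of_ae_eq_mul hcont hA, closure_range_inv_one_add_exp]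
  · intro c U hU
    have hAM : A (M U) = c • M U := by rw [← hMT, hU, map_smul]
    have hnull : ∀ᵐ s : ℝ, (((1 + Real.exp (2*Real.pi*s))⁻¹ : ℝ) : ℂ) ≠ c := by
      refine Set.Subsingleton.measure_zero (fun a ha b hb => ?_) _
      have ha' := not_not.mp ha
      have hb' := not_not.mp hb
      exact injective_inv_one_add_exp (ofReal_injective (ha'.trans hb'.symm))
    have hzero : M U = 0 := by
      refine Lp.ext ?_
      filter_upwards [hA (M U), Lp.coeFn_smul c (M U), hnull,
        Lp.coeFn_zero ℂ 2 (volume : Measure ℝ)] with s h1 h2 h3 h4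
      rw [hAM, h2, Pi.smul_apply, smul_eq_mul] at h1
      rw [h4, Pi.zero_apply]
      by_contra hne
      exact h3 (mul_right_cancel₀ hne h1).symm
    exact M.map_eq_zero_iff.mp hzero
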